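/- arXiv:1103.5030 — 2 statements merged into one kernel-verified Lean document; each statement's English description precedes it below -/
import Mathlib

section
/- There exists an absolute constant C such that for all N ≥ 2, all α ∈ [0,1], and all integers a, q with q ≥ 1, gcd(a,q) = 1, and |α − a/q| < 1/q², one has |Λ̂_N(α)| ≤ C · log⁴N · (N/q^{1/2} + N^{4/5} + N^{1/2} q^{1/2}). -/
open Real Filter

/-- Truncated von Mangoldt function: `Λ_N(n) = log p` if `n = p^j ≤ N`, else `0`. -/
noncomputable def LamN (N : ℕ) (n : ℤ) : ℝ :=
  if 1 ≤ n ∧ n ≤ (N : ℤ) then ArithmeticFunction.vonMangoldt n.toNat else 0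

/-- The exponential sum `Λ̂_N(α) = Σ_{n∈ℤ} Λ_N(n) e^{−2πinα}`. -/
noncomputable def LamHat (N : ℕ) (α : ℝ) : ℂ :=
  ∑' n : ℤ, (LamN N n : ℂ) * Complex.exp (-2 * Real.pi * Complex.I * n * α)


namespace Vino

noncomputable def nd (x : ℝ) : ℝ := |x - round x|

lemma nd_nonneg (x : ℝ) : 0 ≤ nd x := abs_nonneg _

noncomputable def ee (α : ℝ) : ℂ := Complex.exp (-2 * Real.pi * Complex.I * α)

lemma norm_ee (α : ℝ) : ‖ee α‖ = 1 := by
  have : ee α = Complex.exp ((-2 * Real.pi * α : ℝ) * Complex.I) := by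
    unfold ee; congr 1; push_cast; ring
  rw [this, Complex.norm_exp_ofReal_mul_I]

lemma ee_pow (α : ℝ) (k : ℕ) : ee α ^ k = ee (k * α) := by
  unfold ee
  rw [← Complex.exp_nat_mul]; congr 1; push_cast; ring

lemma four_nd_le (θ : ℝ) : 4 * nd θ ≤ ‖ee θ - 1‖ := by
  have h1 : ee θ = Complex.exp (Complex.I * ((-2 * Real.pi * (θ - round θ) : ℝ) : ℂ)) := by
    unfold ee
    rw [Complex.exp_eq_exp_iff_exists_int]
    refine ⟨-round θ, ?_⟩
    push_cast; ring
  rw [h1, Complex.norm_exp_I_mul_ofReal_sub_one]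
  have h2 : (-2 * Real.pi * (θ - round θ)) / 2 = -(Real.pi * (θ - round θ)) := by ring
  rw [h2, Real.sin_neg, norm_mul, norm_neg, Real.norm_eq_abs, Real.norm_eq_abs, abs_two]
  have h3 := abs_sub_round θ
  have h4 := Real.mul_abs_le_abs_sin (x := Real.pi * (θ - round θ)) (by
    rw [abs_mul, abs_of_pos Real.pi_pos]; nlinarith [Real.pi_pos])
  rw [abs_mul, abs_of_pos Real.pi_pos] at h4
  have h5 : 2 / Real.pi * (Real.pi * |θ - round θ|) = 2 * |θ - round θ| := by
    field_simp
  unfold nd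
  linarith

lemma geom_bound1 (z : ℂ) (hz : ‖z‖ = 1) (u v : ℕ) :
    ‖∑ m ∈ Finset.Ioc u v, z ^ m‖ ≤ v := by
  refine (norm_sum_le _ _).trans ?_
  simp [hz]

lemma geom_bound2 (θ : ℝ) (u v : ℕ) :
    ‖∑ m ∈ Finset.Ioc u v, ee θ ^ m‖ * nd θ ≤ 1 := by
  rcases le_or_gt v u with h | h
  · simp [Finset.Ioc_eq_empty_of_le h]
  have h1 : (∑ m ∈ Finset.Ioc u v, ee θ ^ m) * (ee θ - 1) = ee θ ^ (v+1) - ee θ ^ (u+1) := by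
    have := geom_sum_Ico_mul (ee θ) (m := u+1) (n := v+1) (by omega)
    rw [← this]
    congr 2
    ext y; simp
  have h2 : ‖∑ m ∈ Finset.Ioc u v, ee θ ^ m‖ * ‖ee θ - 1‖ ≤ 2 := by
    rw [← norm_mul, h1]
    refine (norm_sub_le _ _).trans ?_
    simp [norm_ee]; norm_num
  have h3 := mul_le_mul_of_nonneg_left (four_nd_le θ) (norm_nonneg (∑ m ∈ Finset.Ioc u v, ee θ ^ m))
  linarith

lemma abel_aux (B : ℝ) (n : ℕ) : ∀ (g : ℕ → ℝ) (x : ℕ → ℂ), Monotone g → 0 ≤ g 0 →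
    (∀ j, ‖∑ i ∈ Finset.Ico j (n+1), x i‖ ≤ B) →
    ‖∑ i ∈ Finset.range (n+1), (g i : ℂ) * x i‖ ≤ g n * B := by
  induction n with
  | zero =>
    intro g x hg h0 hB
    have := hB 0
    simp at this ⊢
    rw [abs_of_nonneg h0]
    exact mul_le_mul_of_nonneg_left this h0
  | succ n ih =>
    intro g x hg h0 hB
    have e : ∑ i ∈ Finset.range (n+1+1), (g i : ℂ) * x i =
        (g 0 : ℂ) * ∑ i ∈ Finset.range (n+1+1), x i +
        ∑ i ∈ Finset.range (n+1), ((g (i+1) - g 0 : ℝ) : ℂ) * x (i+1) := by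
      rw [Finset.sum_range_succ', Finset.sum_range_succ' x, mul_add, Finset.mul_sum]
      push_cast
      simp only [sub_mul, Finset.sum_sub_distrib]
      ring
    have h1 := ih (fun i => g (i+1) - g 0) (fun i => x (i+1))
      (fun a b hab => sub_le_sub_right (hg (by omega)) _) (sub_nonneg.2 (hg (by omega)))
      (fun j => by
        have := hB (j+1)
        rwa [← Finset.sum_Ico_add' x j (n+1) 1] at this)
    have h2 := hB 0
    rw [← Finset.range_eq_Ico] at h2
    rw [e]
    refine (norm_add_le _ _).trans ?_
    rw [norm_mul, Complex.norm_real, Real.norm_eq_abs, abs_of_nonneg h0]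
    have h3 := mul_le_mul_of_nonneg_left h2 h0
    linarith

lemma abel (B : ℝ) (g : ℕ → ℝ) (x : ℕ → ℂ) (hg : Monotone g) (h0 : 0 ≤ g 0) (u v : ℕ)
    (hB : ∀ u, ‖∑ m ∈ Finset.Ioc u v, x m‖ ≤ B) :
    ‖∑ m ∈ Finset.Ioc u v, (g m : ℂ) * x m‖ ≤ g v * B := by
  have hB0 : 0 ≤ B := (norm_nonneg _).trans (hB 0)
  have hgv : 0 ≤ g v := h0.trans (hg (Nat.zero_le _))
  rcases le_or_gt v u with h | h
  · simp [Finset.Ioc_eq_empty_of_le h]; positivity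
  obtain ⟨n, rfl⟩ : ∃ n, v = u + 1 + n := ⟨v - (u+1), by omega⟩
  have key := abel_aux B n (fun i => g (u + 1 + i)) (fun i => x (u + 1 + i))
    (fun a b hab => hg (by omega)) (h0.trans (hg (Nat.zero_le _))) (fun j => by
      have h := hB (u + j)
      have e : Finset.Ioc (u+j) (u+1+n) = Finset.Ico (u+1+j) (u+1+(n+1)) := by
        ext y; simp; omega
      rw [e, add_comm (u+1) j, add_comm (u+1) (n+1), ← Finset.sum_Ico_add x j (n+1) (u+1)] at h
      exact h)
  have e : Finset.Ioc u (u+1+n) = Finset.Ico (u+1) (u+1+n+1) := by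
    ext y; simp only [Finset.mem_Ioc, Finset.mem_Ico]; omega
  rw [e, Finset.sum_Ico_eq_sum_range]
  have e2 : u + 1 + n + 1 - (u+1) = n + 1 := by omega
  rw [e2]
  exact key

lemma abel_bound1 (g : ℕ → ℝ) (hg : Monotone g) (h0 : 0 ≤ g 0) (z : ℂ) (hz : ‖z‖ = 1) (u v : ℕ) :
    ‖∑ m ∈ Finset.Ioc u v, (g m : ℂ) * z ^ m‖ ≤ g v * v :=
  abel v g (fun m => z ^ m) hg h0 u v (fun u => geom_bound1 z hz u v)

lemma abel_bound2 (g : ℕ → ℝ) (hg : Monotone g) (h0 : 0 ≤ g 0) (θ : ℝ) (u v : ℕ) :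
    ‖∑ m ∈ Finset.Ioc u v, (g m : ℂ) * ee θ ^ m‖ * nd θ ≤ g v := by
  rcases (nd_nonneg θ).eq_or_lt with h | h
  · rw [← h, mul_zero]; exact h0.trans (hg (Nat.zero_le _))
  have := abel (1 / nd θ) g (fun m => ee θ ^ m) hg h0 u v (fun u => by
    rw [le_div_iff₀ h]; exact geom_bound2 θ u v)
  rw [mul_one_div, le_div_iff₀ h] at this
  exact this

lemma cast_div_le' (N k : ℕ) : ((N / k : ℕ) : ℝ) ≤ (N : ℝ) / k := Nat.cast_div_le

-- spacing
lemma spacing (α : ℝ) (a : ℤ) (q : ℕ) (hq : 1 ≤ q) (hc : Int.gcd a q = 1)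
    (hα : |α - (a : ℝ) / q| < 1 / (q : ℝ) ^ 2) (h : ℤ) (h0 : h ≠ 0) (hh : 2 * |h| ≤ q) (n : ℤ) :
    1 / (2 * q : ℝ) ≤ |h * α - n| := by
  have hq0 : (0:ℝ) < q := by exact_mod_cast hq
  have hne : h * a - n * q ≠ 0 := by
    intro hz
    have hd : (q : ℤ) ∣ h * a := ⟨n, by linarith⟩
    have hd2 : (q : ℤ) ∣ h := by
      refine IsCoprime.dvd_of_dvd_mul_right (z := a) ?_ hd
      exact (Int.isCoprime_iff_gcd_eq_one.2 hc).symm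
    have := Int.le_of_dvd (abs_pos.2 h0) ((dvd_abs _ _).2 hd2)
    have : 0 < |h| := abs_pos.2 h0
    omega
  have h1 : (1:ℝ) ≤ |(h:ℝ) * a - n * q| := by
    have := Int.one_le_abs hne
    exact_mod_cast this
  have h2 : 1 / (q:ℝ) ≤ |(h:ℝ) * (a / q) - n| := by
    have e : (h:ℝ) * (a / q) - n = ((h:ℝ) * a - n * q) / q := by field_simp
    rw [e, abs_div, abs_of_pos hq0]
    gcongr
  have h3 : |(h:ℝ) * (a / q) - n| ≤ |h * α - n| + |(h:ℝ)| * |α - a/q| := by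
    rw [← abs_mul]
    have e : (h:ℝ) * (a / q) - n = (h * α - n) - h * (α - a / q) := by ring
    rw [e]; exact abs_sub _ _
  have h4 : |(h:ℝ)| ≤ q / 2 := by
    have : (2:ℝ) * |(h:ℝ)| ≤ q := by exact_mod_cast hh
    linarith
  have h5 : |(h:ℝ)| * |α - a/q| ≤ q / 2 * (1 / (q:ℝ)^2) := by gcongr
  have h6 : (q:ℝ) / 2 * (1 / (q:ℝ)^2) = 1 / (2*q) := by field_simp
  have h7 : 1 / (q:ℝ) = 1/(2*q) + 1/(2*q) := by field_simp; norm_num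
  linarith


lemma block (α : ℝ) (a : ℤ) (q : ℕ) (hq : 1 ≤ q) (hc : Int.gcd a q = 1)
    (hα : |α - (a : ℝ) / q| < 1 / (q : ℝ) ^ 2) (H : ℝ)
    (hH : ∑ i ∈ Finset.range (2*q), 1 / (i:ℝ) ≤ H)
    (S : Finset ℕ) (hS : ∀ k ∈ S, ∀ l ∈ S, 2 * |(k:ℤ) - l| ≤ q)
    (M : ℝ) (hM : 0 ≤ M) (T : ℕ → ℝ) (h1 : ∀ k ∈ S, T k ≤ M)
    (h2 : ∀ k ∈ S, T k * nd (k * α) ≤ 1) :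
    ∑ k ∈ S, T k ≤ 2 * M + 4 * q * H := by
  have hq0 : (0:ℝ) < q := by exact_mod_cast hq
  set w : ℕ → ℝ := fun i => (if i = 0 then M else 0) + 2 * q * (1 / (i:ℝ)) with hw
  have hw0 : ∀ i, 0 ≤ w i := by
    intro i; simp only [hw]; split_ifs <;> positivity
  set c : ℕ → ℕ := fun k => ⌊2 * q * Int.fract (k * α)⌋₊ with hcdef
  have hfl : ∀ k : ℕ, (c k : ℝ) ≤ 2 * q * Int.fract (k * α) := fun k =>
    Nat.floor_le (by have := Int.fract_nonneg (k * α); positivity)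
  have hfl2 : ∀ k : ℕ, 2 * q * Int.fract (k * α) < c k + 1 := fun k => Nat.lt_floor_add_one _
  have hlt : ∀ k, c k < 2 * q := by
    intro k
    have h := Int.fract_lt_one (k * α)
    have : (c k : ℝ) < 2 * q := lt_of_le_of_lt (hfl k) (by nlinarith)
    exact_mod_cast this
  have hinj : Set.InjOn c S := by
    intro k hk l hl hkl
    by_contra hne
    have hne' : (k:ℤ) - l ≠ 0 := by
      intro h; apply hne; omega
    have hs := spacing α a q hq hc hα ((k:ℤ) - l) hne' (hS k hk l hl)
      (⌊(k:ℝ) * α⌋ - ⌊(l:ℝ) * α⌋)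
    have e : (((k:ℤ) - l : ℤ) : ℝ) * α - ((⌊(k:ℝ) * α⌋ - ⌊(l:ℝ) * α⌋ : ℤ) : ℝ)
        = Int.fract (k * α) - Int.fract (l * α) := by
      unfold Int.fract; push_cast; ring
    rw [e] at hs
    have a1 := hfl k
    have a2 := hfl2 k
    have a3 := hfl l
    have a4 := hfl2 l
    rw [hkl] at a1 a2
    have : 2 * q * |Int.fract (k * α) - Int.fract (l * α)| < 1 := by
      rw [← abs_of_pos (show (0:ℝ) < 2 * q by positivity), ← abs_mul, abs_lt]
      constructor <;> linarith
    have h3 : 2 * q * (1 / (2 * q : ℝ)) = 1 := by field_simp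
    have := mul_le_mul_of_nonneg_left hs (show (0:ℝ) ≤ 2 * q by positivity)
    linarith
  have hT : ∀ k ∈ S, T k ≤ w (c k) + w (2 * q - 1 - c k) := by
    intro k hk
    rcases le_or_gt (T k) 0 with ht | ht
    · exact ht.trans (add_nonneg (hw0 _) (hw0 _))
    by_cases hz : c k = 0
    · have : M ≤ w (c k) := by simp [hw, hz]
      linarith [h1 k hk, hw0 (2 * q - 1 - c k)]
    by_cases hz2 : 2 * q - 1 - c k = 0
    · have : M ≤ w (2 * q - 1 - c k) := by simp [hw, hz2]
      linarith [h1 k hk, hw0 (c k)]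
    have hnd : nd (k * α) = min (Int.fract (k*α)) (1 - Int.fract (k*α)) := abs_sub_round_eq_min _
    have b := h2 k hk
    rcases min_choice (Int.fract (k*α)) (1 - Int.fract (k*α)) with hm | hm
    · rw [hnd, hm] at b
      have hp : (0:ℝ) < c k := by exact_mod_cast Nat.pos_of_ne_zero hz
      have : T k ≤ w (c k) := by
        simp only [hw, hz, if_false, zero_add]
        rw [mul_one_div, le_div_iff₀ hp]
        nlinarith [mul_le_mul_of_nonneg_left (hfl k) ht.le]
      linarith [hw0 (2 * q - 1 - c k)]
    · rw [hnd, hm] at b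
      have hp : (0:ℝ) < ((2 * q - 1 - c k : ℕ) : ℝ) := by exact_mod_cast Nat.pos_of_ne_zero hz2
      have he : ((2 * q - 1 - c k : ℕ) : ℝ) + 1 + c k = 2 * q := by
        have : 2 * q - 1 - c k + 1 + c k = 2 * q := by have := hlt k; omega
        exact_mod_cast this
      have : T k ≤ w (2 * q - 1 - c k) := by
        simp only [hw, hz2, if_false, zero_add]
        rw [mul_one_div, le_div_iff₀ hp]
        have : ((2 * q - 1 - c k : ℕ) : ℝ) ≤ 2 * q * (1 - Int.fract (k*α)) := by
          linarith [hfl2 k]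
        nlinarith [mul_le_mul_of_nonneg_left this ht.le]
      linarith [hw0 (c k)]
  have hsum : ∑ i ∈ Finset.range (2*q), w i ≤ M + 2 * q * H := by
    simp only [hw, Finset.sum_add_distrib, ← Finset.mul_sum]
    gcongr
    rw [Finset.sum_ite_eq']
    split_ifs <;> simp [hM]
  calc ∑ k ∈ S, T k ≤ ∑ k ∈ S, (w (c k) + w (2 * q - 1 - c k)) := Finset.sum_le_sum hT
    _ = ∑ i ∈ S.image c, (w i + w (2 * q - 1 - i)) := by
        rw [Finset.sum_image hinj]
    _ ≤ ∑ i ∈ Finset.range (2*q), (w i + w (2 * q - 1 - i)) := by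
        apply Finset.sum_le_sum_of_subset_of_nonneg
        · intro i hi
          obtain ⟨k, _, rfl⟩ := Finset.mem_image.1 hi
          exact Finset.mem_range.2 (hlt k)
        · intro i _ _; exact add_nonneg (hw0 _) (hw0 _)
    _ = 2 * ∑ i ∈ Finset.range (2*q), w i := by
        rw [Finset.sum_add_distrib, Finset.sum_range_reflect]; ring
    _ ≤ _ := by linarith

lemma typeI (α : ℝ) (a : ℤ) (q : ℕ) (hq : 1 ≤ q) (hc : Int.gcd a q = 1)
    (hα : |α - (a : ℝ) / q| < 1 / (q : ℝ) ^ 2) (H : ℝ) (K : ℕ)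
    (hH : ∑ i ∈ Finset.range (2*q), 1 / (i:ℝ) ≤ H)
    (hH2 : ∑ i ∈ Finset.range (K+1), 1 / (i:ℝ) ≤ H)
    (X : ℝ) (hX : 0 ≤ X) (T : ℕ → ℝ)
    (h1 : ∀ k ∈ Finset.Ioc 0 K, T k ≤ X / k)
    (h2 : ∀ k ∈ Finset.Ioc 0 K, T k * nd (k * α) ≤ 1) :
    ∑ k ∈ Finset.Ioc 0 K, T k ≤ (4 * X / q + 8 * K + 8 * q) * H := by
  have hq0 : (0:ℝ) < q := by exact_mod_cast hq
  have hH1 : 1 ≤ H := by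
    refine le_trans ?_ hH
    have : (1:ℝ) = ∑ i ∈ {1}, 1 / ((i:ℕ):ℝ) := by simp
    refine this.le.trans ?_
    apply Finset.sum_le_sum_of_subset_of_nonneg
    · intro i hi; simp at hi ⊢; omega
    · intros; positivity
  set L := q / 2 + 1 with hL
  have hLpos : 0 < L := by omega
  have hL2 : (q:ℝ) ≤ 2 * L := by
    have : q ≤ 2 * L := by omega
    exact_mod_cast this
  have hmaps : ∀ k ∈ Finset.Ioc 0 K, k / L ∈ Finset.range (K / L + 1) := by
    intro k hk
    simp at hk ⊢
    exact Nat.div_le_div_right hk.2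
  rw [← Finset.sum_fiberwise_of_maps_to hmaps, Finset.sum_range_succ']
  have hsp : ∀ j, ∀ k ∈ (Finset.Ioc 0 K).filter (fun k => k / L = j),
      ∀ l ∈ (Finset.Ioc 0 K).filter (fun k => k / L = j), 2 * |(k:ℤ) - l| ≤ q := by
    intro j k hk l hl
    simp only [Finset.mem_filter, Nat.div_eq_iff hLpos] at hk hl
    have : |(k:ℤ) - l| ≤ (q/2 : ℕ) := by
      rw [abs_le]
      constructor <;> omega
    omega
  have hz : ∑ k ∈ (Finset.Ioc 0 K).filter (fun k => k / L = 0), T k ≤ 8 * q * H := by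
    have := block α a q hq hc hα H hH _ (hsp 0) (2 * q) (by positivity) T (by
      intro k hk
      have hk' := Finset.mem_filter.1 hk
      have hk1 : 0 < k := (Finset.mem_Ioc.1 hk'.1).1
      have hk2 : k < L := by
        rcases Nat.div_eq_zero_iff.1 hk'.2 with h | h
        · omega
        · exact h
      rcases le_or_gt (T k) 0 with ht | ht
      · exact ht.trans (by positivity)
      have s := spacing α a q hq hc hα k (by omega) (by
        rw [abs_of_nonneg (by positivity)]; omega) (round ((k:ℝ) * α))
      have s' : 1 / (2 * q : ℝ) ≤ nd (k * α) := by
        unfold nd; simpa using s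
      have t := mul_le_mul_of_nonneg_left s' ht.le
      have t2 := t.trans (h2 k hk'.1)
      rw [mul_one_div, div_le_one (by positivity)] at t2
      exact t2) (fun k hk => h2 k (Finset.mem_filter.1 hk).1)
    nlinarith
  have hj : ∀ j ∈ Finset.range (K / L),
      ∑ k ∈ (Finset.Ioc 0 K).filter (fun k => k / L = j + 1), T k ≤
        4 * X / q * (1 / ((j + 1 : ℕ) : ℝ)) + 4 * q * H := by
    intro j _
    have hj0 : (0:ℝ) < ((j+1 : ℕ) : ℝ) := by positivity
    have := block α a q hq hc hα H hH _ (hsp (j+1)) (2 * X / q * (1 / ((j + 1 : ℕ) : ℝ)))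
      (by positivity) T (by
      intro k hk
      have hk' := Finset.mem_filter.1 hk
      refine (h1 k hk'.1).trans ?_
      have hle : (j + 1) * L ≤ k := by
        rw [← hk'.2]; exact Nat.div_mul_le_self k L
      have hle' : (((j + 1 : ℕ) : ℝ)) * L ≤ k := by exact_mod_cast hle
      have hle2 : (((j + 1 : ℕ) : ℝ)) * q / 2 ≤ k := by nlinarith
      have : 2 * X / q * (1 / ((j + 1 : ℕ) : ℝ)) = X / ((((j + 1 : ℕ) : ℝ)) * q / 2) := by
        field_simp
      rw [this]
      gcongr) (fun k hk => h2 k (Finset.mem_filter.1 hk).1)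
    have e : 2 * (2 * X / q * (1 / ((j + 1 : ℕ) : ℝ))) = 4 * X / q * (1 / ((j + 1 : ℕ) : ℝ)) := by
      ring
    linarith
  have hs := Finset.sum_le_sum hj
  rw [Finset.sum_add_distrib, ← Finset.mul_sum] at hs
  have hhar : ∑ j ∈ Finset.range (K / L), 1 / ((j + 1 : ℕ) : ℝ) ≤ H := by
    refine le_trans ?_ hH2
    rw [Finset.sum_range_succ']
    simp only [Nat.cast_zero, div_zero, add_zero]
    apply Finset.sum_le_sum_of_subset_of_nonneg
    · intro i hi; simp at hi ⊢
      exact lt_of_lt_of_le hi (Nat.div_le_self _ _)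
    · intros; positivity
  have hconst : ∑ j ∈ Finset.range (K / L), 4 * (q:ℝ) * H ≤ 8 * K * H := by
    simp only [Finset.sum_const, Finset.card_range, nsmul_eq_mul]
    have hKL : ((K / L : ℕ) : ℝ) * L ≤ K := by exact_mod_cast Nat.div_mul_le_self K L
    have : ((K / L : ℕ) : ℝ) * q ≤ 2 * K := by
      have : ((K / L : ℕ) : ℝ) * q ≤ ((K / L : ℕ) : ℝ) * (2 * L) := by gcongr
      linarith
    nlinarith
  have hfirst : 4 * X / q * ∑ j ∈ Finset.range (K / L), 1 / ((j + 1 : ℕ) : ℝ) ≤ 4 * X / q * H := by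
    gcongr
  nlinarith


open Finset ComplexConjugate in
lemma cs_expand (α : ℝ) (N V : ℕ) (F : ℕ → ℝ) :
    ∑ b ∈ Ioc V N, (b:ℝ) * ‖∑ m ∈ Ioc 0 (N / b), (F m : ℂ) * ee (b * α) ^ m‖ ^ 2 ≤
    ∑ m ∈ Ioc 0 N, ∑ l ∈ Ioc 0 N, |F m| * |F l| *
      ‖∑ b ∈ Ioc V N, if b * m ≤ N ∧ b * l ≤ N then
        (b:ℂ) * (ee α ^ (b * m) * conj (ee α ^ (b * l))) else 0‖ := by
  have hT : ∀ b ∈ Ioc V N, ∑ m ∈ Ioc 0 (N / b), (F m : ℂ) * ee (b * α) ^ m =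
      ∑ m ∈ Ioc 0 N, if b * m ≤ N then (F m : ℂ) * ee α ^ (b * m) else 0 := by
    intro b hb
    have hb0 : 0 < b := by have := mem_Ioc.1 hb; omega
    rw [← sum_filter]
    have : (Ioc 0 N).filter (fun m => b * m ≤ N) = Ioc 0 (N / b) := by
      ext m
      simp only [mem_filter, mem_Ioc, Nat.le_div_iff_mul_le hb0]
      constructor
      · rintro ⟨⟨h1, h2⟩, h3⟩; exact ⟨h1, by rw [mul_comm]; exact h3⟩
      · rintro ⟨h1, h2⟩
        refine ⟨⟨h1, ?_⟩, by rw [mul_comm]; exact h2⟩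
        nlinarith
    rw [this]
    refine sum_congr rfl fun m _ => ?_
    rw [← ee_pow, pow_mul]
  have key : ((∑ b ∈ Ioc V N, (b:ℝ) * ‖∑ m ∈ Ioc 0 (N / b), (F m : ℂ) * ee (b * α) ^ m‖ ^ 2 : ℝ) : ℂ)
      = ∑ m ∈ Ioc 0 N, ∑ l ∈ Ioc 0 N, (F m : ℂ) * (F l : ℂ) *
      ∑ b ∈ Ioc V N, if b * m ≤ N ∧ b * l ≤ N then
        (b:ℂ) * (ee α ^ (b * m) * conj (ee α ^ (b * l))) else 0 := by
    push_cast
    have : ∀ b ∈ Ioc V N, (b:ℂ) * (‖∑ m ∈ Ioc 0 (N / b), (F m : ℂ) * ee (b * α) ^ m‖ : ℂ) ^ 2 =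
        ∑ m ∈ Ioc 0 N, ∑ l ∈ Ioc 0 N, (F m : ℂ) * (F l : ℂ) * (if b * m ≤ N ∧ b * l ≤ N then
        (b:ℂ) * (ee α ^ (b * m) * conj (ee α ^ (b * l))) else 0) := by
      intro b hb
      rw [← Complex.mul_conj', hT b hb, map_sum, sum_mul_sum, mul_sum]
      refine sum_congr rfl fun m _ => ?_
      rw [mul_sum]
      refine sum_congr rfl fun l _ => ?_
      by_cases h1 : b * m ≤ N <;> by_cases h2 : b * l ≤ N <;> simp [h1, h2]
      ring
    rw [sum_congr rfl this, sum_comm]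
    refine sum_congr rfl fun m _ => ?_
    rw [sum_comm]
    refine sum_congr rfl fun l _ => ?_
    rw [mul_sum]
  have h0 : 0 ≤ ∑ b ∈ Ioc V N, (b:ℝ) * ‖∑ m ∈ Ioc 0 (N / b), (F m : ℂ) * ee (b * α) ^ m‖ ^ 2 := by
    positivity
  rw [← Complex.norm_of_nonneg h0, key]
  refine (norm_sum_le _ _).trans (sum_le_sum fun m _ => (norm_sum_le _ _).trans (sum_le_sum fun l _ => ?_))
  rw [norm_mul, norm_mul, Complex.norm_real, Complex.norm_real, Real.norm_eq_abs, Real.norm_eq_abs]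

open Finset ComplexConjugate in
lemma inner_eq (α : ℝ) (N V m l : ℕ) (hl : l ≤ m) (hm : 0 < m) :
    (∑ b ∈ Ioc V N, if b * m ≤ N ∧ b * l ≤ N then
        (b:ℂ) * (ee α ^ (b * m) * conj (ee α ^ (b * l))) else 0) =
    ∑ b ∈ Ioc V (N / m), ((b:ℝ):ℂ) * ee ((m - l : ℕ) * α) ^ b := by
  rw [← sum_filter]
  have : (Ioc V N).filter (fun b => b * m ≤ N ∧ b * l ≤ N) = Ioc V (N / m) := by
    ext b
    simp only [mem_filter, mem_Ioc, Nat.le_div_iff_mul_le hm]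
    constructor
    · rintro ⟨⟨h1, h2⟩, h3, h4⟩; exact ⟨h1, h3⟩
    · rintro ⟨h1, h2⟩
      exact ⟨⟨h1, by nlinarith⟩, h2, (Nat.mul_le_mul_left _ hl).trans h2⟩
  rw [this]
  refine sum_congr rfl fun b _ => ?_
  rw [← ee_pow, ← pow_mul]
  push_cast
  congr 1
  have hz : ee α * conj (ee α) = 1 := by
    rw [Complex.mul_conj', norm_ee]; simp
  have e : b * m = (m - l) * b + b * l := by
    obtain ⟨d, rfl⟩ := Nat.exists_eq_add_of_le hl
    simp; ring
  rw [e, pow_add, map_pow, mul_assoc, ← mul_pow, hz]; simp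

open Finset ComplexConjugate in
lemma typeII (α : ℝ) (a : ℤ) (q : ℕ) (hq : 1 ≤ q) (hc : Int.gcd a q = 1)
    (hα : |α - (a : ℝ) / q| < 1 / (q : ℝ) ^ 2) (H : ℝ) (N U V : ℕ) (hU : 1 ≤ U) (hV : 1 ≤ V)
    (hH1 : 1 ≤ H)
    (hH : ∑ i ∈ Finset.range (2*q), 1 / (i:ℝ) ≤ H)
    (hH2 : ∑ i ∈ Finset.range (N+1), 1 / (i:ℝ) ≤ H) (L : ℝ) 
    (β F : ℕ → ℝ) (hβ : ∀ b, |β b| ≤ 1) (hF : ∀ m ∈ Ioc 0 N, |F m| ≤ L)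
    (hFU : ∀ m ≤ U, F m = 0) :
    ‖∑ b ∈ Ioc V N, (β b : ℂ) * ∑ m ∈ Ioc 0 (N / b), (F m : ℂ) * ee (b * α) ^ m‖ ^ 2 ≤
      2 * L ^ 2 * H ^ 3 * ((N:ℝ)^2 / U + 4 * N^2 / q + 8 * N * q + 8 * N ^ 2 / V) := by
  have hq0 : (0:ℝ) < q := by exact_mod_cast hq
  have hU0 : (0:ℝ) < U := by exact_mod_cast hU
  have hV0 : (0:ℝ) < V := by exact_mod_cast hV
  have hIoc : ∀ W : ℕ, ∑ b ∈ Ioc W N, 1 / (b:ℝ) ≤ H := by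
    intro W
    refine le_trans ?_ hH2
    apply Finset.sum_le_sum_of_subset_of_nonneg
    · intro i hi; simp at hi ⊢; omega
    · intros; positivity
  set D : ℝ := (N:ℝ)^2 / U + 4 * N^2 / q + 8 * N * q + 8 * N ^ 2 / V with hD
  have hD0 : 0 ≤ D := by positivity
  set J : ℕ → ℕ → ℝ := fun m h => ‖∑ b ∈ Ioc V (N / m), ((b:ℝ):ℂ) * ee (h * α) ^ b‖ with hJ
  have hJ0 : ∀ m h, 0 ≤ J m h := fun m h => norm_nonneg _
  -- the per-m bound
  have hper : ∀ m ∈ Ioc 0 N, U < m → J m 0 + ∑ h ∈ Ioc 0 m, J m h ≤ 1 / (m:ℝ) * (H * D) := by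
    intro m hm hUm
    have hm' := mem_Ioc.1 hm
    have hm0 : (0:ℝ) < m := by exact_mod_cast hm'.1
    rcases le_or_gt (N / m) V with hv | hv
    · have : ∀ h, J m h = 0 := by intro h; simp [hJ, Ioc_eq_empty_of_le hv]
      simp only [this, sum_const_zero, add_zero]
      positivity
    have hmono : Monotone (fun b : ℕ => (b:ℝ)) := fun a b h => Nat.cast_le.2 h
    have hvm : ((N / m : ℕ) : ℝ) ≤ (N:ℝ) / m := Nat.cast_div_le
    have hv0 : (0:ℝ) < ((N / m : ℕ) : ℝ) := by
      have : 0 < N / m := by omega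
      exact_mod_cast this
    have b1 : ∀ h, J m h ≤ ((N / m : ℕ) : ℝ) * ((N / m : ℕ) : ℝ) := fun h =>
      abel_bound1 (fun b : ℕ => (b:ℝ)) hmono (by simp) _ (norm_ee _) V (N / m)
    have b2 : ∀ h : ℕ, J m h * nd (h * α) ≤ ((N / m : ℕ) : ℝ) := fun h =>
      abel_bound2 (fun b : ℕ => (b:ℝ)) hmono (by simp) _ V (N / m)
    have hHm : ∑ i ∈ Finset.range (m+1), 1 / (i:ℝ) ≤ H := by
      refine le_trans ?_ hH2
      apply Finset.sum_le_sum_of_subset_of_nonneg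
      · intro i hi; simp at hi ⊢; omega
      · intros; positivity
    have t := typeI α a q hq hc hα H m hH hHm N (by positivity)
      (fun h => J m h / ((N / m : ℕ) : ℝ)) (by
        intro h hh
        have hh' := mem_Ioc.1 hh
        have hh0 : (0:ℝ) < h := by exact_mod_cast hh'.1
        have hhm : (h:ℝ) ≤ m := by exact_mod_cast hh'.2
        calc J m h / ((N / m : ℕ) : ℝ) ≤ ((N / m : ℕ) : ℝ) := by
              rw [div_le_iff₀ hv0]; exact b1 h
          _ ≤ (N:ℝ) / m := hvm
          _ ≤ (N:ℝ) / h := by gcongr) (by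
        intro h hh
        rw [div_mul_eq_mul_div, div_le_one hv0]; exact b2 h)
    rw [← sum_div, div_le_iff₀ hv0] at t
    have hmV : (V:ℝ) * m ≤ N := by
      have : V * m ≤ N := (Nat.le_div_iff_mul_le hm'.1).1 hv.le
      exact_mod_cast this
    have hUm' : (U:ℝ) ≤ m := by exact_mod_cast hUm.le
    have c0 : J m 0 ≤ 1 / (m:ℝ) * ((N:ℝ)^2 / U) := by
      refine (b1 0).trans ?_
      calc ((N / m : ℕ) : ℝ) * ((N / m : ℕ) : ℝ) ≤ (N:ℝ) / m * (N / m) := by gcongr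
        _ = 1 / (m:ℝ) * ((N:ℝ)^2 / m) := by field_simp
        _ ≤ _ := by gcongr
    have c1 : ∑ h ∈ Ioc 0 m, J m h ≤ 1 / (m:ℝ) * (H * (4 * N^2 / q + 8 * N * q + 8 * N ^ 2 / V)) := by
      refine t.trans ?_
      calc (4 * (N:ℝ) / q + 8 * m + 8 * q) * H * ((N / m : ℕ) : ℝ)
          ≤ (4 * (N:ℝ) / q + 8 * m + 8 * q) * H * ((N:ℝ) / m) := by gcongr
        _ = 1 / (m:ℝ) * (H * (4 * N^2 / q + 8 * N * q + 8 * N * m)) := by field_simp; ring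
        _ ≤ _ := by
          have : 8 * (N:ℝ) * m ≤ 8 * N ^ 2 / V := by
            rw [le_div_iff₀ hV0]
            nlinarith [Nat.cast_nonneg (α := ℝ) N]
          gcongr
    have c2 : 1 / (m:ℝ) * ((N:ℝ)^2 / U) ≤ 1 / (m:ℝ) * (H * ((N:ℝ)^2 / U)) := by
      gcongr
      exact le_mul_of_one_le_left (by positivity) hH1
    calc _ ≤ 1 / (m:ℝ) * (H * ((N:ℝ)^2 / U)) + 1 / (m:ℝ) * (H * (4 * N^2 / q + 8 * N * q + 8 * N ^ 2 / V)) := by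
          linarith
      _ = _ := by rw [hD]; ring
  -- symmetric double sum
  set G : ℕ → ℕ → ℝ := fun m l => |F m| * |F l| *
      ‖∑ b ∈ Ioc V N, if b * m ≤ N ∧ b * l ≤ N then
        (b:ℂ) * (ee α ^ (b * m) * conj (ee α ^ (b * l))) else 0‖ with hG
  have hG0 : ∀ m l, 0 ≤ G m l := fun m l => by simp only [hG]; positivity
  have hGs : ∀ m l, G m l = G l m := by
    intro m l
    simp only [hG]
    rw [mul_comm |F m|, ← Complex.norm_conj, map_sum]
    congr 2
    refine sum_congr rfl fun b _ => ?_
    by_cases h1 : b * m ≤ N <;> by_cases h2 : b * l ≤ N <;> simp [h1, h2]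
    exact Or.inl (mul_comm _ _)
  have hrow : ∀ m ∈ Ioc 0 N, ∑ l ∈ Ioc 0 N, (if l ≤ m then G m l else 0) ≤
      L ^ 2 * (1 / (m:ℝ) * (H * D)) := by
    intro m hm
    have hm' := mem_Ioc.1 hm
    rcases le_or_gt m U with hu | hu
    · have : ∀ l, G m l = 0 := by intro l; simp [hG, hFU m hu]
      simp only [this, ite_self, sum_const_zero]
      positivity
    refine le_trans ?_ (mul_le_mul_of_nonneg_left (hper m hm hu) (sq_nonneg L))
    rw [← sum_filter]
    have e1 : (Ioc 0 N).filter (fun l => l ≤ m) = Ioc 0 m := by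
      ext l; simp only [mem_filter, mem_Ioc]; omega
    rw [e1]
    calc ∑ l ∈ Ioc 0 m, G m l ≤ ∑ l ∈ Ioc 0 m, L ^ 2 * J m (m - l) := by
          refine sum_le_sum fun l hl => ?_
          have hl' := mem_Ioc.1 hl
          simp only [hG, hJ]
          rw [inner_eq α N V m l hl'.2 hm'.1]
          gcongr
          rw [sq]
          have f1 := hF m hm
          have f2 := hF l (by simp only [mem_Ioc]; omega)
          have := abs_nonneg (F m)
          gcongr
          linarith
      _ = L ^ 2 * ∑ h ∈ (Ioc 0 m).image (fun l => m - l), J m h := by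
          rw [← mul_sum, sum_image]
          intro x hx y hy hxy
          simp only [coe_Ioc, Set.mem_Ioc] at hx hy hxy
          omega
      _ ≤ L ^ 2 * ∑ h ∈ range (m + 1), J m h := by
          refine mul_le_mul_of_nonneg_left ?_ (sq_nonneg L)
          apply Finset.sum_le_sum_of_subset_of_nonneg
          · intro h hh
            simp only [mem_image, mem_Ioc, mem_range] at hh ⊢; omega
          · intros; exact hJ0 _ _
      _ = L ^ 2 * (J m 0 + ∑ h ∈ Ioc 0 m, J m h) := by
          congr 1
          have : range (m + 1) = insert 0 (Ioc 0 m) := by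
            ext x; simp only [mem_range, mem_insert, mem_Ioc]; omega
          rw [this, sum_insert (by simp)]
  have hhalf : ∑ m ∈ Ioc 0 N, ∑ l ∈ Ioc 0 N, (if l ≤ m then G m l else 0) ≤ L ^ 2 * (H * (H * D)) := by
    refine (sum_le_sum hrow).trans ?_
    rw [← mul_sum, ← sum_mul]
    have := hIoc 0
    gcongr
  have hfull : ∑ m ∈ Ioc 0 N, ∑ l ∈ Ioc 0 N, G m l ≤ 2 * (L ^ 2 * (H * (H * D))) := by
    calc ∑ m ∈ Ioc 0 N, ∑ l ∈ Ioc 0 N, G m l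
        ≤ ∑ m ∈ Ioc 0 N, ∑ l ∈ Ioc 0 N, ((if l ≤ m then G m l else 0) + (if m ≤ l then G l m else 0)) := by
          refine sum_le_sum fun m _ => sum_le_sum fun l _ => ?_
          rcases le_total l m with h | h
          · rw [if_pos h]
            have : 0 ≤ (if m ≤ l then G l m else 0) := by split_ifs <;> simp [hG0]
            linarith
          · rw [if_pos h, hGs m l]
            have : 0 ≤ (if l ≤ m then G l m else 0) := by split_ifs <;> simp [hG0]
            linarith
      _ = ∑ m ∈ Ioc 0 N, ∑ l ∈ Ioc 0 N, (if l ≤ m then G m l else 0) +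
          ∑ m ∈ Ioc 0 N, ∑ l ∈ Ioc 0 N, (if l ≤ m then G m l else 0) := by
          simp only [sum_add_distrib]
          congr 1
          rw [sum_comm]
      _ ≤ _ := by linarith
  have hexp := (cs_expand α N V F).trans hfull
  set T : ℕ → ℂ := fun b => ∑ m ∈ Ioc 0 (N / b), (F m : ℂ) * ee (b * α) ^ m with hT
  have h1 : ‖∑ b ∈ Ioc V N, (β b : ℂ) * T b‖ ≤ ∑ b ∈ Ioc V N, ‖T b‖ := by
    refine (norm_sum_le _ _).trans (sum_le_sum fun b _ => ?_)
    rw [norm_mul, Complex.norm_real, Real.norm_eq_abs]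
    exact mul_le_of_le_one_left (norm_nonneg _) (hβ b)
  have h2 : (∑ b ∈ Ioc V N, ‖T b‖) ^ 2 ≤ (∑ b ∈ Ioc V N, 1 / (b:ℝ)) * ∑ b ∈ Ioc V N, (b:ℝ) * ‖T b‖ ^ 2 := by
    apply sum_sq_le_sum_mul_sum_of_sq_le_mul
    · intros; positivity
    · intros; positivity
    · intro b hb
      have : (0:ℝ) < b := by
        have := (mem_Ioc.1 hb).1
        have : 0 < b := by omega
        exact_mod_cast this
      apply le_of_eq; field_simp
  calc ‖∑ b ∈ Ioc V N, (β b : ℂ) * T b‖ ^ 2 ≤ (∑ b ∈ Ioc V N, ‖T b‖) ^ 2 := by gcongr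
    _ ≤ _ := h2
    _ ≤ H * (2 * (L ^ 2 * (H * (H * D)))) := by
      have := hIoc V
      gcongr
    _ = _ := by ring


open Finset in
lemma hyper (f g : ArithmeticFunction ℝ) (h : ℕ → ℂ) (N : ℕ) :
    ∑ n ∈ Ioc 0 N, (((f * g) n : ℝ) : ℂ) * h n =
    ∑ d ∈ Ioc 0 N, (f d : ℂ) * ∑ m ∈ Ioc 0 (N / d), (g m : ℂ) * h (d * m) := by
  trans ∑ x ∈ Ioc 0 N ×ˢ Ioc 0 N with x.1 * x.2 ≤ N, (f x.1 : ℂ) * (g x.2 : ℂ) * h (x.1 * x.2)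
  · trans ∑ n ∈ Ioc 0 N, ∑ x ∈ Ioc 0 N ×ˢ Ioc 0 N with x.1 * x.2 = n,
        (f x.1 : ℂ) * (g x.2 : ℂ) * h (x.1 * x.2)
    · refine sum_congr rfl fun n hn ↦ ?_
      simp only [mem_Ioc] at hn
      rw [ArithmeticFunction.mul_apply, Nat.divisorsAntidiagonal_eq_prod_filter_of_le hn.1.ne' hn.2]
      push_cast
      rw [sum_mul]
      refine sum_congr rfl fun x hx => ?_
      rw [(mem_filter.1 hx).2]
    · simp_rw [sum_filter]
      rw [sum_comm]
      refine sum_congr rfl fun x hx ↦ ?_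
      simp only [mem_product, mem_Ioc] at hx
      have : 0 < x.1 * x.2 := Nat.mul_pos hx.1.1 hx.2.1
      simp [this]
  · rw [sum_filter, sum_product]
    refine sum_congr rfl fun n hn ↦ ?_
    have hn0 := (mem_Ioc.1 hn).1
    rw [← sum_filter, mul_sum]
    have : (Ioc 0 N).filter (fun m => n * m ≤ N) = Ioc 0 (N / n) := by
      ext m
      simp only [mem_filter, mem_Ioc, Nat.le_div_iff_mul_le hn0]
      constructor
      · rintro ⟨⟨h1, h2⟩, h3⟩; exact ⟨h1, by rw [mul_comm]; exact h3⟩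
      · rintro ⟨h1, h2⟩
        refine ⟨⟨h1, ?_⟩, by rw [mul_comm]; exact h2⟩
        nlinarith
    rw [this]
    exact sum_congr rfl fun m _ => by ring

noncomputable def lo (U : ℕ) (f : ArithmeticFunction ℝ) : ArithmeticFunction ℝ :=
  ⟨fun n => if n ≤ U then f n else 0, by simp⟩

lemma lo_apply (U : ℕ) (f : ArithmeticFunction ℝ) (n : ℕ) :
    lo U f n = if n ≤ U then f n else 0 := rfl

noncomputable def mu : ArithmeticFunction ℝ := (ArithmeticFunction.moebius : ArithmeticFunction ℝ)

noncomputable def ze : ArithmeticFunction ℝ := (ArithmeticFunction.zeta : ArithmeticFunction ℝ)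

lemma af_sub (f g : ArithmeticFunction ℝ) (n : ℕ) : (f - g) n = f n - g n := by
  rw [sub_eq_add_neg, ArithmeticFunction.add_apply, sub_eq_add_neg]; rfl

open ArithmeticFunction in
lemma vaughan (U V : ℕ) : vonMangoldt = lo U vonMangoldt + lo V mu * ArithmeticFunction.log
    - lo V mu * lo U vonMangoldt * ze + (mu - lo V mu) * ((vonMangoldt - lo U vonMangoldt) * ze) := by
  have h1 : mu * ze = 1 := coe_moebius_mul_coe_zeta
  have h2 : vonMangoldt * ze = ArithmeticFunction.log := vonMangoldt_mul_zeta
  linear_combination -(vonMangoldt - lo U vonMangoldt) * h1 + lo V mu * h2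

lemma abs_mu_le (n : ℕ) : |mu n| ≤ 1 := by
  unfold mu
  rw [ArithmeticFunction.intCoe_apply]
  exact_mod_cast ArithmeticFunction.abs_moebius_le_one

lemma abs_lo_mu_le (V n : ℕ) : |lo V mu n| ≤ 1 := by
  rw [lo_apply]; split_ifs
  · exact abs_mu_le n
  · simp

open ArithmeticFunction in
lemma lo_vM_le (U n : ℕ) : |lo U vonMangoldt n| ≤ vonMangoldt n := by
  rw [lo_apply]; split_ifs
  · rw [abs_of_nonneg vonMangoldt_nonneg]
  · simp [vonMangoldt_nonneg]

open ArithmeticFunction in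
lemma hi_vM_le (U n : ℕ) : |(vonMangoldt - lo U vonMangoldt : ArithmeticFunction ℝ) n| ≤ vonMangoldt n := by
  have : (vonMangoldt - lo U vonMangoldt : ArithmeticFunction ℝ) n = vonMangoldt n - lo U vonMangoldt n := af_sub _ _ _
  rw [this, lo_apply]; split_ifs
  · simp [vonMangoldt_nonneg]
  · simp [abs_of_nonneg vonMangoldt_nonneg]

open ArithmeticFunction in
lemma conv_le (f g : ArithmeticFunction ℝ) (hf : ∀ n, |f n| ≤ 1) (hg : ∀ n, |g n| ≤ vonMangoldt n) (k : ℕ) :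
    |(f * g) k| ≤ Real.log k := by
  rw [mul_apply]
  refine (Finset.abs_sum_le_sum_abs _ _).trans ?_
  have : Real.log k = ∑ x ∈ k.divisorsAntidiagonal, vonMangoldt x.2 := by
    rw [← vonMangoldt_sum, Nat.sum_divisorsAntidiagonal' (fun _ j => vonMangoldt j)]
  rw [this]
  refine Finset.sum_le_sum fun x _ => ?_
  rw [abs_mul]
  calc |f x.1| * |g x.2| ≤ 1 * vonMangoldt x.2 := by
        gcongr
        · exact hf _
        · exact hg _
    _ = _ := one_mul _

lemma harm (n : ℕ) : ∑ i ∈ Finset.range (n+1), 1 / (i:ℝ) ≤ 1 + Real.log n := by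
  have := harmonic_le_one_add_log n
  rw [Finset.sum_range_succ']
  unfold harmonic at this
  push_cast at this
  simpa using this

open Finset in
lemma typeI_app (α : ℝ) (a : ℤ) (q : ℕ) (hq : 1 ≤ q) (hc : Int.gcd a q = 1)
    (hα : |α - (a : ℝ) / q| < 1 / (q : ℝ) ^ 2) (H : ℝ) (N K : ℕ) (hK : K ≤ N)
    (hH : ∑ i ∈ Finset.range (2*q), 1 / (i:ℝ) ≤ H)
    (hH2 : ∑ i ∈ Finset.range (N+1), 1 / (i:ℝ) ≤ H)
    (c g : ℕ → ℝ) (A G : ℝ) (hG : 0 < G) (hcK : ∀ k, K < k → c k = 0)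
    (hcA : ∀ k ∈ Ioc 0 N, |c k| ≤ A) (hA : 0 ≤ A)
    (hg : Monotone g) (hg0 : 0 ≤ g 0) (hgN : g N ≤ G) :
    ‖∑ k ∈ Ioc 0 N, (c k : ℂ) * ∑ m ∈ Ioc 0 (N / k), (g m : ℂ) * ee (k * α) ^ m‖ ≤
      A * (G * ((4 * N / q + 8 * K + 8 * q) * H)) := by
  set I : ℕ → ℂ := fun k => ∑ m ∈ Ioc 0 (N / k), (g m : ℂ) * ee (k * α) ^ m with hI
  have e : ∑ k ∈ Ioc 0 N, (c k : ℂ) * I k = ∑ k ∈ Ioc 0 K, (c k : ℂ) * I k := by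
    symm
    apply sum_subset
    · intro x hx; simp only [mem_Ioc] at hx ⊢; omega
    · intro x hx hx'
      simp only [mem_Ioc] at hx hx'
      rw [hcK x (by omega)]; simp
  rw [e]
  have hgk : ∀ k : ℕ, g (N / k) ≤ G := fun k => (hg (Nat.div_le_self _ _)).trans hgN
  have hHK : ∑ i ∈ Finset.range (K+1), 1 / (i:ℝ) ≤ H := by
    refine le_trans ?_ hH2
    apply Finset.sum_le_sum_of_subset_of_nonneg
    · intro i hi; simp at hi ⊢; omega
    · intros; positivity
  have t := typeI α a q hq hc hα H K hH hHK N (by positivity) (fun k => ‖I k‖ / G) (by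
      intro k hk
      rw [div_le_iff₀ hG]
      have := abel_bound1 g hg hg0 (ee (k * α)) (norm_ee _) 0 (N / k)
      refine this.trans ?_
      rw [mul_comm]
      have h1 := hgk k
      have h3 : 0 ≤ g (N / k) := hg0.trans (hg (Nat.zero_le _))
      have h2 : ((N / k : ℕ) : ℝ) ≤ (N:ℝ) / k := Nat.cast_div_le
      gcongr) (by
      intro k hk
      rw [div_mul_eq_mul_div, div_le_one hG]
      exact (abel_bound2 g hg hg0 (k * α) 0 (N / k)).trans (hgk k))
  rw [← sum_div, div_le_iff₀ hG] at t
  calc ‖∑ k ∈ Ioc 0 K, (c k : ℂ) * I k‖ ≤ ∑ k ∈ Ioc 0 K, A * ‖I k‖ := by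
        refine (norm_sum_le _ _).trans (sum_le_sum fun k hk => ?_)
        rw [norm_mul, Complex.norm_real, Real.norm_eq_abs]
        gcongr
        apply hcA
        simp only [mem_Ioc] at hk ⊢; omega
    _ = A * ∑ k ∈ Ioc 0 K, ‖I k‖ := by rw [mul_sum]
    _ ≤ A * (G * ((4 * N / q + 8 * K + 8 * q) * H)) := by
        rw [mul_comm G]; gcongr

open Finset ArithmeticFunction in
lemma trivial_bound (N : ℕ) (α : ℝ) :
    ‖∑ n ∈ Ioc 0 N, (vonMangoldt n : ℂ) * ee α ^ n‖ ≤ N * Real.log N := by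
  calc _ ≤ ∑ n ∈ Ioc 0 N, Real.log N := by
        refine (norm_sum_le _ _).trans (sum_le_sum fun n hn => ?_)
        have := mem_Ioc.1 hn
        rw [norm_mul, norm_pow, norm_ee, one_pow, mul_one, Complex.norm_real, Real.norm_eq_abs,
          abs_of_nonneg vonMangoldt_nonneg]
        refine vonMangoldt_le_log.trans (Real.log_le_log (by exact_mod_cast this.1) (by exact_mod_cast this.2))
    _ = _ := by simp

open Finset ArithmeticFunction in
lemma main_bound (α : ℝ) (a : ℤ) (q : ℕ) (hq : 1 ≤ q) (hc : Int.gcd a q = 1)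
    (hα : |α - (a : ℝ) / q| < 1 / (q : ℝ) ^ 2) (H : ℝ) (N U : ℕ) (hN : 2 ≤ N) (hU : 1 ≤ U)
    (hUN : U * U ≤ N) (hH1 : 1 ≤ H)
    (hH : ∑ i ∈ Finset.range (2*q), 1 / (i:ℝ) ≤ H)
    (hH2 : ∑ i ∈ Finset.range (N+1), 1 / (i:ℝ) ≤ H) :
    ∃ s : ℝ, s ^ 2 ≤ 2 * Real.log N ^ 2 * H ^ 3 *
        ((N:ℝ)^2 / U + 4 * N^2 / q + 8 * N * q + 8 * N ^ 2 / U) ∧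
      ‖∑ n ∈ Ioc 0 N, (vonMangoldt n : ℂ) * ee α ^ n‖ ≤
      U * Real.log N + Real.log N * ((4 * N / q + 8 * U + 8 * q) * H) +
       Real.log N * ((4 * N / q + 8 * (U * U) + 8 * q) * H) + s := by
  have hlog : 0 < Real.log N := Real.log_pos (by exact_mod_cast hN)
  have hUN' : U ≤ N := by nlinarith
  have hlogle : ∀ n ∈ Ioc 0 N, Real.log n ≤ Real.log N := by
    intro n hn
    have := mem_Ioc.1 hn
    exact Real.log_le_log (by exact_mod_cast this.1) (by exact_mod_cast this.2)
  have hpow : ∀ d m : ℕ, ee α ^ (d * m) = ee (d * α) ^ m := by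
    intro d m; rw [← ee_pow, pow_mul]
  have e : ∑ n ∈ Ioc 0 N, (vonMangoldt n : ℂ) * ee α ^ n =
      ∑ n ∈ Ioc 0 N, (lo U vonMangoldt n : ℂ) * ee α ^ n
      + ∑ n ∈ Ioc 0 N, (((lo U mu * ArithmeticFunction.log) n : ℝ) : ℂ) * ee α ^ n
      - ∑ n ∈ Ioc 0 N, (((lo U mu * lo U vonMangoldt * ze) n : ℝ) : ℂ) * ee α ^ n
      + ∑ n ∈ Ioc 0 N, ((((mu - lo U mu) * ((vonMangoldt - lo U vonMangoldt) * ze)) n : ℝ) : ℂ) * ee α ^ n := by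
    rw [← sum_add_distrib, ← sum_sub_distrib, ← sum_add_distrib]
    refine sum_congr rfl fun n _ => ?_
    have := congrArg (fun f : ArithmeticFunction ℝ => f n) (vaughan U U)

    rw [this]
    simp only [ArithmeticFunction.add_apply, af_sub]
    push_cast
    ring
  have s1 : ‖∑ n ∈ Ioc 0 N, (lo U vonMangoldt n : ℂ) * ee α ^ n‖ ≤ U * Real.log N := by
    have e1 : ∑ n ∈ Ioc 0 N, (lo U vonMangoldt n : ℂ) * ee α ^ n =
        ∑ n ∈ Ioc 0 U, (vonMangoldt n : ℂ) * ee α ^ n := by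
      symm
      rw [← sum_subset (Ioc_subset_Ioc_right hUN')]
      · refine sum_congr rfl fun n hn => ?_
        rw [lo_apply, if_pos (mem_Ioc.1 hn).2]
      · intro n hn hn'
        rw [lo_apply, if_neg]; · simp
        simp only [mem_Ioc] at hn hn'; omega
    rw [e1]
    refine (trivial_bound U α).trans ?_
    gcongr
  have hlogmono : Monotone (fun n : ℕ => Real.log n) := by
    intro x y hxy
    rcases Nat.eq_zero_or_pos x with h | h
    · subst h; simp; exact Real.log_natCast_nonneg y
    · exact Real.log_le_log (by exact_mod_cast h) (by exact_mod_cast hxy)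
  have s2 : ‖∑ n ∈ Ioc 0 N, (((lo U mu * ArithmeticFunction.log) n : ℝ) : ℂ) * ee α ^ n‖ ≤
      1 * (Real.log N * ((4 * N / q + 8 * U + 8 * q) * H)) := by
    rw [hyper]
    simp only [hpow, ArithmeticFunction.log_apply]
    exact typeI_app α a q hq hc hα H N U hUN' hH hH2 (fun k => lo U mu k) (fun n => Real.log n) 1
      (Real.log N) hlog (fun k hk => by simp [lo_apply, hk.not_ge]) (fun k _ => abs_lo_mu_le U k)
      zero_le_one hlogmono (by simp) le_rfl
  have s3 : ‖∑ n ∈ Ioc 0 N, (((lo U mu * lo U vonMangoldt * ze) n : ℝ) : ℂ) * ee α ^ n‖ ≤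
      Real.log N * (1 * ((4 * N / q + 8 * (U * U : ℕ) + 8 * q) * H)) := by
    rw [hyper]
    have hz : ∀ k : ℕ, ∑ m ∈ Ioc 0 (N / k), (ze m : ℂ) * ee α ^ (k * m) =
        ∑ m ∈ Ioc 0 (N / k), ((1:ℝ) : ℂ) * ee (k * α) ^ m := by
      intro k
      refine sum_congr rfl fun m hm => ?_
      have : m ≠ 0 := by have := (mem_Ioc.1 hm).1; omega
      rw [hpow]
      simp [ze, natCoe_apply, zeta_apply, this]
    simp only [hz]
    refine typeI_app α a q hq hc hα H N (U * U) hUN hH hH2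
      (fun k => (lo U mu * lo U vonMangoldt) k) (fun n => 1) (Real.log N) 1 one_pos ?_ ?_ hlog.le
      monotone_const zero_le_one le_rfl
    · intro k hk
      simp only [mul_apply]
      refine sum_eq_zero fun x hx => ?_
      have hx' := (Nat.mem_divisorsAntidiagonal.1 hx).1
      rw [lo_apply, lo_apply]
      split_ifs with h1 h2
      · exfalso
        have := Nat.mul_le_mul h1 h2
        omega
      all_goals simp
    · intro k hk
      exact (conv_le _ _ (abs_lo_mu_le U) (lo_vM_le U) k).trans (hlogle k hk)
  have s4 := typeII α a q hq hc hα H N U U hU hU hH1 hH hH2 (Real.log N)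
    (fun b => (mu - lo U mu) b) (fun m => ((vonMangoldt - lo U vonMangoldt) * ze) m)
    (by
      intro b
      simp only [af_sub, lo_apply]
      split_ifs
      · simp
      · simpa using abs_mu_le b)
    (by
      intro m hm
      rw [mul_comm]
      refine (conv_le _ _ ?_ (hi_vM_le U) m).trans (hlogle m hm)
      intro n
      simp only [ze, natCoe_apply, zeta_apply]
      split_ifs <;> simp)
    (by
      intro m hm
      rw [mul_apply]
      refine sum_eq_zero fun x hx => ?_
      have hx' := Nat.mem_divisorsAntidiagonal.1 hx
      have : x.1 ≤ U := (Nat.le_of_dvd (Nat.pos_of_ne_zero hx'.2) ⟨x.2, hx'.1.symm⟩).trans hm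
      simp [af_sub, lo_apply, this])
  refine ⟨_, s4, ?_⟩
  rw [e]
  have e4 : ∑ n ∈ Ioc 0 N, ((((mu - lo U mu) * ((vonMangoldt - lo U vonMangoldt) * ze)) n : ℝ) : ℂ) * ee α ^ n
      = ∑ b ∈ Ioc U N, (((mu - lo U mu) b : ℝ) : ℂ) * ∑ m ∈ Ioc 0 (N / b),
        ((((vonMangoldt - lo U vonMangoldt) * ze) m : ℝ) : ℂ) * ee (b * α) ^ m := by
    rw [hyper]
    simp only [hpow]
    symm
    apply sum_subset (Ioc_subset_Ioc_left (Nat.zero_le _))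
    intro x hx hx'
    have : x ≤ U := by simp only [mem_Ioc] at hx hx'; omega
    simp [af_sub, lo_apply, this]
  rw [e4]
  push_cast at s3
  rw [one_mul] at s2 s3
  have n1 := norm_add_le (∑ n ∈ Ioc 0 N, (lo U vonMangoldt n : ℂ) * ee α ^ n
      + ∑ n ∈ Ioc 0 N, (((lo U mu * ArithmeticFunction.log) n : ℝ) : ℂ) * ee α ^ n
      - ∑ n ∈ Ioc 0 N, (((lo U mu * lo U vonMangoldt * ze) n : ℝ) : ℂ) * ee α ^ n)
      (∑ b ∈ Ioc U N, (((mu - lo U mu) b : ℝ) : ℂ) * ∑ m ∈ Ioc 0 (N / b),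
        ((((vonMangoldt - lo U vonMangoldt) * ze) m : ℝ) : ℂ) * ee (b * α) ^ m)
  have n2 := norm_sub_le (∑ n ∈ Ioc 0 N, (lo U vonMangoldt n : ℂ) * ee α ^ n
      + ∑ n ∈ Ioc 0 N, (((lo U mu * ArithmeticFunction.log) n : ℝ) : ℂ) * ee α ^ n)
      (∑ n ∈ Ioc 0 N, (((lo U mu * lo U vonMangoldt * ze) n : ℝ) : ℂ) * ee α ^ n)
  have n3 := norm_add_le (∑ n ∈ Ioc 0 N, (lo U vonMangoldt n : ℂ) * ee α ^ n)
      (∑ n ∈ Ioc 0 N, (((lo U mu * ArithmeticFunction.log) n : ℝ) : ℂ) * ee α ^ n)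
  linarith


open Finset in
lemma lamhat_eq (N : ℕ) (α : ℝ) : LamHat N α =
    ∑ n ∈ Ioc 0 N, (ArithmeticFunction.vonMangoldt n : ℂ) * ee α ^ n := by
  unfold LamHat
  rw [tsum_eq_sum (s := (Ioc 0 N).image (fun n : ℕ => (n:ℤ)))]
  · rw [sum_image (by intro x _ y _ h; exact Int.ofNat_injective h)]
    refine sum_congr rfl fun n hn => ?_
    have hn' := mem_Ioc.1 hn
    have : (1:ℤ) ≤ n ∧ (n:ℤ) ≤ N := by omega
    unfold LamN
    rw [if_pos this, ee_pow, ee]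
    simp only [Int.toNat_natCast]
    congr 2
    push_cast; ring
  · intro n hn
    unfold LamN
    rw [if_neg]
    · simp
    · rintro ⟨h1, h2⟩
      apply hn
      simp only [mem_image, mem_Ioc]
      exact ⟨n.toNat, by omega, by omega⟩

lemma final_ineq (L X P A B Nn Q r U H s t : ℝ) (hL : 69/100 ≤ L) (hP : 0 ≤ P) (hA : 0 ≤ A) (hB : 0 ≤ B)
    (hX : X = A + P + B) (hNQ : Nn / Q ≤ A) (hQB : Q ≤ B)
    (hUP : U ≤ P) (hUUP : U * U ≤ P) 
    (hH1 : 1 ≤ H) (hHL : H ≤ 4 * L) (hA2 : Nn ^ 2 / Q = A ^ 2) (hB2 : Nn * Q = B ^ 2)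
    (hN2 : Nn ^ 2 / U ≤ 2 * P ^ 2)
    (hs : s ^ 2 ≤ 2 * L ^ 2 * H ^ 3 * (Nn^2 / U + 4 * Nn^2 / Q + 8 * Nn * Q + 8 * Nn ^ 2 / U))
    (ht : t ≤ U * L + L * ((4 * Nn / Q + 8 * U + 8 * Q) * H) +
       L * ((4 * Nn / Q + 8 * (U * U) + 8 * Q) * H) + s) :
    t ≤ 400 * L ^ 4 * X := by
  have hX0 : 0 ≤ X := by rw [hX]; positivity
  have hL0 : 0 < L := by linarith
  have hL2 : 1/4 ≤ L ^ 2 := by nlinarith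
  have hL3 : 1/4 ≤ L ^ 3 := by
    calc (1/4 : ℝ) ≤ (69/100) ^ 3 := by norm_num
      _ ≤ L ^ 3 := by gcongr
  have h1 : U * L ≤ 4 * L ^ 4 * X := by
    have : U ≤ X := by rw [hX]; linarith
    have h : L * X ≤ 4 * L ^ 4 * X := by
      have : 0 ≤ L * X := by positivity
      nlinarith
    have : U * L ≤ X * L := by gcongr
    linarith
  have e : 4 * Nn / Q = 4 * (Nn / Q) := by ring
  have hsm : ∀ K, K ≤ P → L * ((4 * Nn / Q + 8 * K + 8 * Q) * H) ≤ 128 * L ^ 4 * X := by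
    intro K hK
    have a1 : 4 * Nn / Q + 8 * K + 8 * Q ≤ 8 * X := by rw [hX, e]; linarith
    calc L * ((4 * Nn / Q + 8 * K + 8 * Q) * H) ≤ L * ((8 * X) * (4 * L)) := by gcongr
      _ = 32 * L ^ 2 * X := by ring
      _ ≤ 128 * L ^ 4 * X := by
        have : 0 ≤ L ^ 2 * X := by positivity
        nlinarith
  have hs' : s ≤ 96 * L ^ 4 * X := by
    apply le_of_sq_le_sq ?_ (by positivity)
    refine hs.trans ?_
    have b : Nn^2 / U + 4 * Nn^2 / Q + 8 * Nn * Q + 8 * Nn ^ 2 / U ≤ 18 * X ^ 2 := by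
      have : Nn^2 / U + 4 * Nn^2 / Q + 8 * Nn * Q + 8 * Nn ^ 2 / U =
        9 * (Nn ^ 2 / U) + 4 * (Nn ^ 2 / Q) + 8 * (Nn * Q) := by ring
      rw [this, hA2, hB2, hX]
      nlinarith [mul_nonneg hA hP, mul_nonneg hA hB, mul_nonneg hB hP, sq_nonneg A, sq_nonneg B]
    calc _ ≤ 2 * L ^ 2 * H ^ 3 * (18 * X ^ 2) := by gcongr
      _ ≤ 2 * L ^ 2 * (4 * L) ^ 3 * (18 * X ^ 2) := by gcongr
      _ = 2304 * (L ^ 5 * X ^ 2) := by ring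
      _ ≤ 2304 * (4 * L ^ 3 * (L ^ 5 * X ^ 2)) := by
        have : 0 ≤ L ^ 5 * X ^ 2 := by positivity
        nlinarith
      _ = _ := by ring
  have := hsm U hUP
  have := hsm (U * U) hUUP
  have : 0 ≤ L ^ 4 * X := by positivity
  linarith

end Vino

open Vino

theorem stmt6 :
    ∃ C : ℝ, ∀ N : ℕ, 2 ≤ N → ∀ α ∈ Set.Icc (0:ℝ) 1, ∀ a : ℤ, ∀ q : ℕ,
      1 ≤ q → Int.gcd a q = 1 → |α - (a : ℝ) / q| < 1 / (q : ℝ) ^ 2 →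
      ‖LamHat N α‖ ≤ C * Real.log N ^ 4 *
        ((N : ℝ) / Real.sqrt q + (N : ℝ) ^ ((4 : ℝ) / 5) + Real.sqrt N * Real.sqrt q) := by
  refine ⟨400, ?_⟩
  intro N hN α _ a q hq hc hα
  rw [lamhat_eq]
  have hNr : (2:ℝ) ≤ N := by exact_mod_cast hN
  have hN0 : (0:ℝ) < N := by linarith
  have hN1 : (1:ℝ) ≤ N := by linarith
  have hqr : (1:ℝ) ≤ q := by exact_mod_cast hq
  have hq0 : (0:ℝ) < q := by linarith
  have hlog2 : (69/100 : ℝ) ≤ Real.log 2 := by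
    have := Real.log_two_gt_d9; norm_num at this ⊢; linarith
  have hL : (69/100 : ℝ) ≤ Real.log N := hlog2.trans (Real.log_le_log (by norm_num) hNr)
  have hsN : Real.sqrt N ^ 2 = N := Real.sq_sqrt hN0.le
  have hsq : Real.sqrt q ^ 2 = q := Real.sq_sqrt hq0.le
  have hsN0 : 0 < Real.sqrt N := Real.sqrt_pos.2 hN0
  have hsq0 : 0 < Real.sqrt q := Real.sqrt_pos.2 hq0
  have hsq1 : 1 ≤ Real.sqrt q := Real.one_le_sqrt.2 hqr
  rcases le_or_gt q N with hqN | hqN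
  · have hqNr : (q:ℝ) ≤ N := by exact_mod_cast hqN
    have hsqN : Real.sqrt q ≤ Real.sqrt N := Real.sqrt_le_sqrt hqNr
    have hqB : (q:ℝ) ≤ Real.sqrt N * Real.sqrt q := by
      calc (q:ℝ) = Real.sqrt q * Real.sqrt q := by rw [← sq, hsq]
        _ ≤ _ := by gcongr
    have hsqq : Real.sqrt q ≤ q := by
      calc Real.sqrt q ≤ Real.sqrt q ^ 2 := le_self_pow₀ hsq1 (by norm_num)
        _ = q := hsq
    set r : ℝ := (N:ℝ) ^ ((2:ℝ)/5) with hr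
    have hr1 : 1 ≤ r := Real.one_le_rpow hN1 (by norm_num)
    have hP : (N:ℝ) ^ ((4:ℝ)/5) = r ^ 2 := by
      rw [hr, ← Real.rpow_natCast, ← Real.rpow_mul hN0.le]; norm_num
    have hN5 : (N:ℝ) ^ 2 = r ^ 5 := by
      rw [hr, ← Real.rpow_natCast, ← Real.rpow_natCast, ← Real.rpow_mul hN0.le]; norm_num
    have hPN : r ^ 2 ≤ N := by
      rw [← hP]
      calc (N:ℝ) ^ ((4:ℝ)/5) ≤ (N:ℝ) ^ (1:ℝ) := Real.rpow_le_rpow_of_exponent_le hN1 (by norm_num)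
        _ = N := Real.rpow_one _
    set U : ℕ := ⌊r⌋₊ with hUdef
    have hU1 : 1 ≤ U := Nat.one_le_floor_iff r |>.2 hr1
    have hU1r : (1:ℝ) ≤ U := by exact_mod_cast hU1
    have hUr : (U:ℝ) ≤ r := Nat.floor_le (by linarith)
    have hUr2 : r ≤ 2 * U := by
      have := Nat.lt_floor_add_one r
      rw [← hUdef] at this
      linarith
    have hUU : (U:ℝ) * U ≤ r ^ 2 := by nlinarith
    have hUUN : U * U ≤ N := by
      have : (U:ℝ) * U ≤ N := hUU.trans hPN
      exact_mod_cast this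
    have hlog2N : Real.log (2 * N) = Real.log 2 + Real.log N :=
      Real.log_mul (by norm_num) hN0.ne'
    have hH1 : 1 ≤ 1 + Real.log (2 * N) := by rw [hlog2N]; linarith
    have hHq : ∑ i ∈ Finset.range (2*q), 1 / (i:ℝ) ≤ 1 + Real.log (2 * N) := by
      have h := harm (2 * q - 1)
      rw [show 2 * q - 1 + 1 = 2 * q by omega] at h
      refine h.trans ?_
      have h1 : 0 < 2 * q - 1 := by omega
      have h2 : 2 * q - 1 ≤ 2 * N := by omega
      gcongr
      exact_mod_cast h2
    have hHN : ∑ i ∈ Finset.range (N+1), 1 / (i:ℝ) ≤ 1 + Real.log (2 * N) := by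
      refine (harm N).trans ?_
      rw [hlog2N]; linarith
    obtain ⟨s, hs, ht⟩ := main_bound α a q hq hc hα (1 + Real.log (2 * N)) N U hN hU1 hUUN hH1 hHq hHN
    refine final_ineq (Real.log N) _ (r ^ 2) (N / Real.sqrt q) (Real.sqrt N * Real.sqrt q) N q r U
      (1 + Real.log (2 * N)) s _ hL (by positivity) (by positivity) (by positivity) (by rw [hP]) ?_ ?_
      ?_ hUU hH1 ?_ ?_ ?_ ?_ hs ht
    · gcongr
    · exact hqB
    · calc (U:ℝ) ≤ r := hUr
        _ ≤ r ^ 2 := le_self_pow₀ hr1 (by norm_num)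
    · rw [hlog2N]
      have := Real.log_le_log (by norm_num) hNr
      have := Real.log_two_lt_d9
      norm_num at this
      linarith
    · rw [div_pow, hsq]
    · rw [mul_pow, hsq, hsN]
    · rw [hN5, div_le_iff₀ (by linarith)]
      calc r ^ 5 = r ^ 4 * r := by ring
        _ ≤ r ^ 4 * (2 * U) := by gcongr
        _ = _ := by ring
  · refine (trivial_bound N α).trans ?_
    have hqNr : (N:ℝ) ≤ q := by exact_mod_cast hqN.le
    have hsqN : Real.sqrt N ≤ Real.sqrt q := Real.sqrt_le_sqrt hqNr
    have h1 : (N:ℝ) ≤ Real.sqrt N * Real.sqrt q := by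
      calc (N:ℝ) = Real.sqrt N * Real.sqrt N := by rw [← sq, hsN]
        _ ≤ _ := by gcongr
    set X := (N : ℝ) / Real.sqrt q + (N : ℝ) ^ ((4 : ℝ) / 5) + Real.sqrt N * Real.sqrt q with hX
    have h2 : (N:ℝ) ≤ X := by
      have : 0 ≤ (N : ℝ) / Real.sqrt q := by positivity
      have : 0 ≤ (N : ℝ) ^ ((4 : ℝ) / 5) := by positivity
      linarith
    have hX0 : 0 ≤ X := by linarith
    set L := Real.log N
    have hL3 : 1/4 ≤ L ^ 3 := by
      calc (1/4 : ℝ) ≤ (69/100) ^ 3 := by norm_num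
        _ ≤ L ^ 3 := by gcongr
    have hL0 : 0 < L := by linarith
    calc (N:ℝ) * L ≤ X * L := by gcongr
      _ ≤ 400 * L ^ 4 * X := by
        have : 0 ≤ L * X := by positivity
        nlinarith
end

section
/- Let f(x) = c_k x^k + ⋯ + c_0 ∈ ℤ[x] with c_k > 0 and k ≥ 1, and let B > 0. There is a constant C (depending on f and B) such that for all N ≥ 2, if α = a/q + β with 1 ≤ q ≤ log^B N, gcd(a,q) = 1, and |β| < log^B N / N, then |S_M(α) − q^{−1} S_{a/q} I_M(β)| ≤ C · log^{2B} N, where M = (N/c_k)^{1/k}. -/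
open Real Filter MeasureTheory

/-- The Weyl sum `S_M(α) = Σ_{d=1}^{M} e^{2πi f(d) α}`. -/
noncomputable def SM (f : Polynomial ℤ) (M : ℕ) (α : ℝ) : ℂ :=
  ∑ d ∈ Finset.Icc 1 M, Complex.exp (2 * Real.pi * Complex.I * (f.eval (d : ℤ)) * α)

/-- The complete exponential sum `S_{a/q} = Σ_{r=0}^{q−1} e^{2πi f(r) a/q}`. -/
noncomputable def Saq (f : Polynomial ℤ) (a : ℤ) (q : ℕ) : ℂ :=
  ∑ r ∈ Finset.range q,
    Complex.exp (2 * Real.pi * Complex.I * (f.eval (r : ℤ)) * a / q)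

/-- `I_M(β) = ∫_0^M e^{2πi f(x) β} dx`, with `f` evaluated at real `x`. -/
noncomputable def IM (f : Polynomial ℤ) (M : ℝ) (β : ℝ) : ℂ :=
  ∫ x in (0:ℝ)..M, Complex.exp (2 * Real.pi * Complex.I * (Polynomial.aeval x f : ℝ) * β)

/-- `M = (N/c_k)^{1/k}` as a real number. -/
noncomputable def Mreal (f : Polynomial ℤ) (k : ℕ) (N : ℕ) : ℝ :=
  ((N : ℝ) / (f.leadingCoeff : ℝ)) ^ ((1 : ℝ) / k)


lemma aux_main (q : ℕ) (hq : 1 ≤ q) (w : ℕ → ℂ) (g : ℝ → ℂ) (hg : Continuous g) (K X : ℝ)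
    (hK : 0 ≤ K)
    (hw : ∀ d, ‖w d‖ ≤ 1) (hper : ∀ n r, w (n * q + r) = w r)
    (hL : ∀ x ∈ Set.Icc 0 X, ∀ y ∈ Set.Icc 0 X, ‖g x - g y‖ ≤ K * |x - y|) (n : ℕ)
    (hn : ((n * q : ℕ) : ℝ) ≤ X) :
    ‖∑ d ∈ Finset.range (n * q), w d * g d -
      (1 / (q : ℂ)) * (∑ r ∈ Finset.range q, w r) * ∫ x in (0:ℝ)..((n * q : ℕ) : ℝ), g x‖
      ≤ n * (q * (q * K)) := by
  induction n with
  | zero => simp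
  | succ n ih =>
    have hq0 : (0:ℝ) < q := by exact_mod_cast hq
    have hq0c : (q:ℂ) ≠ 0 := by exact_mod_cast hq0.ne'
    have e1 : (((n+1) * q : ℕ) : ℝ) = ((n * q : ℕ) : ℝ) + q := by push_cast; ring
    rw [e1] at hn
    have ih' := ih (by linarith)
    set A : ℝ := ((n * q : ℕ) : ℝ) with hA
    have hA0 : 0 ≤ A := by positivity
    rw [e1, Nat.succ_mul, Finset.sum_range_add,
      ← intervalIntegral.integral_add_adjacent_intervals (hg.intervalIntegrable 0 A)
        (hg.intervalIntegrable A (A+q))]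
    have key : ‖∑ r ∈ Finset.range q, w (n * q + r) * g ((n * q + r : ℕ) : ℝ) -
        (1 / (q : ℂ)) * (∑ r ∈ Finset.range q, w r) * ∫ x in A..(A+q), g x‖ ≤ q * (q * K) := by
      have : ∑ r ∈ Finset.range q, w (n * q + r) * g ((n * q + r : ℕ) : ℝ) -
        (1 / (q : ℂ)) * (∑ r ∈ Finset.range q, w r) * (∫ x in A..(A+q), g x) =
        ∑ r ∈ Finset.range q, w r * ((1 / (q:ℂ)) * ∫ x in A..(A+q), (g (A + r) - g x)) := by
        rw [Finset.mul_sum, Finset.sum_mul, ← Finset.sum_sub_distrib]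
        refine Finset.sum_congr rfl fun r _ => ?_
        rw [hper, intervalIntegral.integral_sub (by simp) (hg.intervalIntegrable _ _),
          intervalIntegral.integral_const]
        have : ((n * q + r : ℕ) : ℝ) = A + r := by rw [hA]; push_cast; ring
        rw [this]
        simp only [add_sub_cancel_left, Complex.real_smul]
        push_cast
        field_simp
      rw [this]
      calc _ ≤ ∑ r ∈ Finset.range q, q * K := by
            refine norm_sum_le_of_le _ fun r hr => ?_
            have hr' : (r:ℝ) ≤ q := by exact_mod_cast (Finset.mem_range.1 hr).le
            have hr0 : (0:ℝ) ≤ r := by positivity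
            have hi : ‖∫ x in A..(A+q), (g (A + r) - g x)‖ ≤ (K * q) * |A + q - A| := by
              refine intervalIntegral.norm_integral_le_of_norm_le_const fun x hx => ?_
              rw [Set.uIoc_of_le (by linarith)] at hx
              refine (hL _ ⟨by linarith, by linarith⟩ _ ⟨by linarith [hx.1], by linarith [hx.2]⟩).trans ?_
              refine mul_le_mul_of_nonneg_left ?_ hK
              rw [abs_le]; constructor <;> linarith [hx.1, hx.2]
            rw [add_sub_cancel_left, abs_of_pos hq0] at hi
            rw [norm_mul, norm_mul]
            have h1 : ‖(1 / (q:ℂ))‖ = 1 / q := by simp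
            rw [h1]
            calc _ ≤ 1 * (1 / (q:ℝ) * (K * q * q)) := by
                  gcongr
                  exact hw r
              _ = q * K := by field_simp
        _ = _ := by simp
    calc _ = ‖(∑ d ∈ Finset.range (n * q), w d * g d -
      (1 / (q : ℂ)) * (∑ r ∈ Finset.range q, w r) * ∫ x in (0:ℝ)..A, g x) + 
        (∑ r ∈ Finset.range q, w (n * q + r) * g ((n * q + r : ℕ) : ℝ) -
        (1 / (q : ℂ)) * (∑ r ∈ Finset.range q, w r) * ∫ x in A..(A+q), g x)‖ := by
          congr 1; ring
      _ ≤ n * (q * (q * K)) + q * (q * K) := (norm_add_le _ _).trans (add_le_add ih' key)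
      _ = _ := by push_cast; ring

lemma aux_full (q : ℕ) (hq : 1 ≤ q) (w : ℕ → ℂ) (g : ℝ → ℂ) (hg : Continuous g) (K X : ℝ)
    (hK : 0 ≤ K) (hX : 0 ≤ X)
    (hw : ∀ d, ‖w d‖ ≤ 1) (hper : ∀ n r, w (n * q + r) = w r) (hg1 : ∀ x, ‖g x‖ ≤ 1)
    (hL : ∀ x ∈ Set.Icc 0 X, ∀ y ∈ Set.Icc 0 X, ‖g x - g y‖ ≤ K * |x - y|) :
    ‖∑ d ∈ Finset.Icc 1 ⌊X⌋₊, w d * g d -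
      (1 / (q : ℂ)) * (∑ r ∈ Finset.range q, w r) * ∫ x in (0:ℝ)..X, g x‖
      ≤ X * q * K + (2 * q + 2) := by
  have hq0 : (0:ℝ) < q := by exact_mod_cast hq
  set T := ⌊X⌋₊ with hT
  have hTX : (T:ℝ) ≤ X := Nat.floor_le hX
  have hXT : X < T + 1 := Nat.lt_floor_add_one X
  set n := T / q with hn
  have hdm : T = n * q + T % q := by rw [hn, mul_comm]; exact (Nat.div_add_mod T q).symm
  have hmod : T % q < q := Nat.mod_lt _ hq
  set s := T % q
  have hnq : ((n * q : ℕ) : ℝ) ≤ X := le_trans (by exact_mod_cast (by omega : n * q ≤ T)) hTX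
  have hXn : X - ((n * q : ℕ) : ℝ) ≤ q := by
    have : ((T + 1 : ℕ):ℝ) ≤ ((n * q + q : ℕ) : ℝ) := by exact_mod_cast (by omega)
    push_cast at this ⊢
    linarith
  have h1 := aux_main q hq w g hg K X hK hw hper hL n hnq
  have hterm : ∀ d : ℕ, ‖w d * g d‖ ≤ 1 := fun d => by
    rw [norm_mul]; exact mul_le_one₀ (hw d) (norm_nonneg _) (hg1 _)
  have hsum : ∑ d ∈ Finset.Icc 1 T, w d * g d =
      ∑ d ∈ Finset.range (n * q), w d * g d + 
      ∑ r ∈ Finset.range s, w (n * q + r) * g ((n * q + r : ℕ) : ℝ) + w T * g T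
        - w 0 * g (0:ℕ) := by
    rw [← Finset.sum_range_add (fun d : ℕ => w d * g d), ← hdm,
      ← Finset.sum_range_succ (fun d : ℕ => w d * g d), Finset.sum_range_succ' (fun d : ℕ => w d * g d),
      add_sub_cancel_right, Finset.range_eq_Ico, Finset.sum_Ico_add' (fun d : ℕ => w d * g d)]
    rfl
  have hs : ‖∑ r ∈ Finset.range s, w (n * q + r) * g ((n * q + r : ℕ) : ℝ)‖ ≤ q := by
    refine (norm_sum_le_of_le _ (fun r _ => hterm (n*q+r))).trans ?_
    simp
    exact_mod_cast hmod.le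
  have hS : ‖(1 / (q : ℂ)) * (∑ r ∈ Finset.range q, w r)‖ ≤ 1 := by
    rw [norm_mul]
    have : ‖∑ r ∈ Finset.range q, w r‖ ≤ q := by
      refine (norm_sum_le_of_le _ (fun r _ => hw r)).trans ?_
      simp
    have h1 : ‖(1 / (q:ℂ))‖ = 1 / q := by simp
    rw [h1]
    calc _ ≤ 1 / (q:ℝ) * q := by gcongr
      _ = 1 := by field_simp
  have hI : ‖∫ x in ((n * q : ℕ) : ℝ)..X, g x‖ ≤ q := by
    refine (intervalIntegral.norm_integral_le_of_norm_le_const (fun x _ => hg1 x)).trans ?_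
    rw [one_mul, abs_of_nonneg (by linarith)]
    exact hXn
  have hSI : ‖(1 / (q : ℂ)) * (∑ r ∈ Finset.range q, w r) * ∫ x in ((n * q : ℕ) : ℝ)..X, g x‖ ≤ q := by
    rw [norm_mul]
    calc _ ≤ 1 * (q:ℝ) := by gcongr
      _ = q := one_mul _
  rw [hsum, ← intervalIntegral.integral_add_adjacent_intervals (hg.intervalIntegrable 0 ((n * q : ℕ) : ℝ))
        (hg.intervalIntegrable _ X)]
  have h2 : (n:ℝ) * (q * (q * K)) ≤ X * q * K := by
    have : (n:ℝ) * (q * (q * K)) = ((n * q : ℕ) : ℝ) * (q * K) := by push_cast; ring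
    rw [this, mul_assoc]
    gcongr
  set P := (1 / (q : ℂ)) * (∑ r ∈ Finset.range q, w r)
  rw [mul_add]
  calc _ = ‖(∑ d ∈ Finset.range (n * q), w d * g d - P * ∫ x in (0:ℝ)..((n * q : ℕ) : ℝ), g x)
      + ∑ r ∈ Finset.range s, w (n * q + r) * g ((n * q + r : ℕ) : ℝ) + w T * g T
        - w 0 * g (0:ℕ) - P * ∫ x in ((n * q : ℕ) : ℝ)..X, g x‖ := by congr 1; ring
    _ ≤ n * (q * (q * K)) + q + 1 + 1 + q := by
      refine (norm_sub_le _ _).trans (add_le_add ?_ hSI)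
      refine (norm_sub_le _ _).trans (add_le_add ?_ (hterm 0))
      refine (norm_add_le _ _).trans (add_le_add ?_ (hterm T))
      exact (norm_add_le _ _).trans (add_le_add h1 hs)
    _ ≤ _ := by linarith

lemma aux_poly (p : Polynomial ℝ) (m : ℕ) (hm : p.natDegree ≤ m) :
    ∃ D : ℝ, 0 ≤ D ∧ ∀ X : ℝ, ∀ x ∈ Set.Icc 0 X, |p.eval x| ≤ D * (max 1 X) ^ m := by
  refine ⟨∑ i ∈ Finset.range (p.natDegree + 1), |p.coeff i|, by positivity, fun X x hx => ?_⟩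
  rw [Polynomial.eval_eq_sum_range, Finset.sum_mul]
  refine (Finset.abs_sum_le_sum_abs _ _).trans (Finset.sum_le_sum fun i hi => ?_)
  rw [abs_mul, abs_pow, abs_of_nonneg hx.1]
  have : i ≤ m := by have := Finset.mem_range.1 hi; omega
  gcongr
  calc x ^ i ≤ (max 1 X) ^ i := pow_le_pow_left₀ hx.1 (hx.2.trans (le_max_right _ _)) _
    _ ≤ _ := pow_le_pow_right₀ (le_max_left _ _) this

lemma aux_norm (t : ℝ) (b : ℝ) : ‖Complex.exp (2 * Real.pi * Complex.I * (t:ℂ) * b)‖ = 1 := by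
  have : 2 * Real.pi * Complex.I * (t:ℂ) * b = ((2 * Real.pi * t * b : ℝ) : ℂ) * Complex.I := by
    push_cast; ring
  rw [this, Complex.norm_exp_ofReal_mul_I]

lemma aux_lip (p : Polynomial ℝ) (b E X : ℝ)
    (hE : ∀ x ∈ Set.Icc 0 X, |p.derivative.eval x| ≤ E) :
    ∀ x ∈ Set.Icc 0 X, ∀ y ∈ Set.Icc 0 X,
      ‖Complex.exp (2 * Real.pi * Complex.I * (p.eval x : ℝ) * b) -
        Complex.exp (2 * Real.pi * Complex.I * (p.eval y : ℝ) * b)‖ ≤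
      (2 * Real.pi * |b| * E) * |x - y| := by
  intro x hx y hy
  have hd : ∀ z : ℝ, HasDerivAt
      (fun z : ℝ => Complex.exp (2 * Real.pi * Complex.I * (p.eval z : ℝ) * b))
      (Complex.exp (2 * Real.pi * Complex.I * (p.eval z : ℝ) * b) *
        (2 * Real.pi * Complex.I * (p.derivative.eval z : ℝ) * b)) z := fun z =>
    (((p.hasDerivAt z).ofReal_comp.const_mul _).mul_const _).cexp
  have := (convex_Icc (0:ℝ) X).norm_image_sub_le_of_norm_hasDerivWithin_le (C := 2 * Real.pi * |b| * E)
    (fun z _ => (hd z).hasDerivWithinAt) (fun z hz => ?_) hy hx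
  · simpa [Real.norm_eq_abs] using this
  · rw [norm_mul, aux_norm]
    simp only [norm_mul, Complex.norm_real, Complex.norm_I, Complex.norm_ofNat, Real.norm_eq_abs,
      abs_of_pos Real.pi_pos, mul_one, one_mul]
    have := mul_le_mul_of_nonneg_left (hE z hz) (show 0 ≤ 2 * Real.pi * |b| by positivity)
    linarith

theorem stmt8 (f : Polynomial ℤ) (k : ℕ) (hk : 1 ≤ k)
    (hdeg : f.natDegree = k) (hlead : 0 < f.leadingCoeff) (B : ℝ) (hB : 0 < B) :
    ∃ C : ℝ, ∀ N : ℕ, 2 ≤ N → ∀ a : ℤ, ∀ q : ℕ, ∀ β : ℝ,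
      1 ≤ q → (q : ℝ) ≤ Real.log N ^ B → Int.gcd a q = 1 →
      |β| < Real.log N ^ B / N →
      ‖SM f ⌊Mreal f k N⌋₊ ((a : ℝ) / q + β) -
          (1 / (q : ℂ)) * Saq f a q * IM f (Mreal f k N) β‖
        ≤ C * Real.log N ^ (2 * B) := by
  set p : Polynomial ℝ := f.map (Int.castRingHom ℝ) with hp
  have hev : ∀ d : ℤ, ((f.eval d : ℤ) : ℂ) = ((p.eval (d:ℝ) : ℝ) : ℂ) := fun d => by
    have : p.eval (d:ℝ) = ((f.eval d : ℤ) : ℝ) := by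
      rw [hp, Polynomial.eval_intCast_map]; rfl
    rw [this]; simp
  have hae : ∀ x : ℝ, Polynomial.aeval x f = p.eval x := fun x => by
    rw [hp, Polynomial.aeval_def, Polynomial.eval_map]; rfl
  obtain ⟨D, hD0, hD⟩ := aux_poly p.derivative (k - 1) (by
    refine (Polynomial.natDegree_derivative_le p).trans ?_
    have : p.natDegree ≤ f.natDegree := Polynomial.natDegree_map_le
    omega)
  refine ⟨4 * Real.pi * D + 4, fun N hN a q β hq hqL _ hβ => ?_⟩
  set L := Real.log N ^ B with hL
  have hN0 : (0:ℝ) < N := by positivity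
  have hN1 : (1:ℝ) ≤ N := by exact_mod_cast (by omega)
  have hlog : 0 ≤ Real.log N := Real.log_nonneg hN1
  have hLL : Real.log N ^ (2 * B) = L * L := by
    rw [hL, two_mul, Real.rpow_add' hlog (by linarith)]
  have hq1 : (1:ℝ) ≤ q := by exact_mod_cast hq
  have hqc : (q:ℂ) ≠ 0 := by exact_mod_cast (by omega : q ≠ 0)
  have hL1 : 1 ≤ L := hq1.trans hqL
  have hc1 : (1:ℝ) ≤ (f.leadingCoeff : ℝ) := by exact_mod_cast hlead
  set X := Mreal f k N with hX
  have hX0 : 0 ≤ X := by rw [hX, Mreal]; positivity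
  have hXk : X ^ k ≤ N := by
    rw [hX, Mreal, one_div, Real.rpow_inv_natCast_pow (by positivity) (by omega)]
    exact div_le_self hN0.le hc1
  have hmx : X * (max 1 X) ^ (k-1) ≤ N := by
    rcases le_total X 1 with h | h
    · rw [max_eq_left h, one_pow]; linarith
    · rw [max_eq_right h, ← pow_succ', Nat.sub_add_cancel hk]; exact hXk
  set w : ℕ → ℂ := fun d => Complex.exp (2 * Real.pi * Complex.I * (f.eval (d : ℤ)) * a / q) with hw
  set g : ℝ → ℂ := fun x => Complex.exp (2 * Real.pi * Complex.I * (p.eval x : ℝ) * β) with hg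
  have hwn : ∀ d, ‖w d‖ ≤ 1 := fun d => by
    have := aux_norm (p.eval ((d:ℤ):ℝ)) ((a:ℝ)/q)
    rw [hw]; simp only
    rw [hev, ← this]
    apply le_of_eq; congr 2; push_cast; ring
  have hper : ∀ n r, w (n * q + r) = w r := fun n r => by
    have h := Polynomial.sub_dvd_eval_sub ((n * q + r : ℕ) : ℤ) (r:ℤ) f
    have h2 : (q:ℤ) ∣ f.eval ((n * q + r : ℕ) : ℤ) - f.eval (r:ℤ) :=
      dvd_trans ⟨n, by push_cast; ring⟩ h
    obtain ⟨m, hm⟩ := h2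
    have hm' : f.eval ((n * q + r : ℕ) : ℤ) = f.eval (r:ℤ) + q * m := by linarith
    rw [hw]; simp only
    rw [hm', Complex.exp_eq_exp_iff_exists_int]
    refine ⟨m * a, ?_⟩
    push_cast; field_simp
  have hgc : Continuous g := by
    have := p.continuous
    fun_prop
  have hm0 : 0 < max 1 X := lt_of_lt_of_le one_pos (le_max_left _ _)
  have := aux_full q hq w g hgc (2 * Real.pi * |β| * (D * (max 1 X) ^ (k-1))) X (by positivity) hX0
    hwn hper (fun x => (aux_norm _ _).le) (aux_lip p β _ X (hD X))
  have e1 : SM f ⌊X⌋₊ ((a : ℝ) / q + β) = ∑ d ∈ Finset.Icc 1 ⌊X⌋₊, w d * g d := by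
    rw [SM]
    refine Finset.sum_congr rfl fun d _ => ?_
    have h3 : ((p.eval (d:ℝ) : ℝ) : ℂ) = ((f.eval (d:ℤ) : ℤ) : ℂ) := by rw [hev]; simp
    simp only [hw, hg]
    rw [h3, ← Complex.exp_add]
    congr 1; push_cast; ring
  have e2 : IM f X β = ∫ x in (0:ℝ)..X, g x := by
    rw [IM]; simp only [hae, hg]
  rw [e1, e2, Saq, hLL]
  refine this.trans ?_
  have hβN : |β| * N ≤ L := ((lt_div_iff₀ hN0).1 hβ).le
  calc _ = (2 * Real.pi * D * q * |β|) * (X * (max 1 X) ^ (k-1)) + (2 * q + 2) := by ring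
    _ ≤ (2 * Real.pi * D * q * |β|) * N + (2 * q + 2) := by gcongr
    _ = (2 * Real.pi * D * q) * (|β| * N) + (2 * q + 2) := by ring
    _ ≤ (2 * Real.pi * D * L) * L + (2 * L + 2) := by gcongr
    _ ≤ (4 * Real.pi * D + 4) * (L * L) := by
      have : 0 ≤ Real.pi * D * (L * L) := by positivity
      nlinarith
end
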